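/- There is a constant c > 0 depending only on n with the following property. Let Ω be a nonempty open convex proper subset of ℝⁿ, let l : ℝⁿ → ℝ be a locally Lipschitz function, and suppose u ∈ C²(Ω) ∩ C⁰(cl Ω) satisfies the minimal surface equation ∑_{i=1}^n D_i( D_i u / √(1+|Du|²) ) = 0 at every point of Ω and u = l on ∂Ω. Then for every r > 0, the n-dimensional Hausdorff measure of the part of the graph of u over Ω inside the ball B_r(0) ⊂ ℝ^{n+1} satisfies H^{n}( { (x, u(x)) : x ∈ Ω } ∩ B_r(0) ) ≤ c rⁿ. -/

import Mathlib

open Set Metric MeasureTheory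
open scoped RealInnerProductSpace ENNReal

/-- The `i`-th partial derivative of `u` at `x`. -/
noncomputable def pderiv' {n : ℕ} (u : EuclideanSpace ℝ (Fin n) → ℝ) (i : Fin n)
    (x : EuclideanSpace ℝ (Fin n)) : ℝ :=
  fderiv ℝ u x (EuclideanSpace.single i 1)

/-- The squared norm of the gradient of `u` at `x`: `|Du|² = ∑ᵢ (Dᵢu)²`. -/
noncomputable def gradSq {n : ℕ} (u : EuclideanSpace ℝ (Fin n) → ℝ)
    (x : EuclideanSpace ℝ (Fin n)) : ℝ :=
  ∑ i, (pderiv' u i x) ^ 2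

/-- `u` satisfies the minimal surface equation
`∑ᵢ Dᵢ( Dᵢu / √(1+|Du|²) ) = 0` at every point of `Ω`. -/
def MinimalSurfaceEq {n : ℕ} (u : EuclideanSpace ℝ (Fin n) → ℝ)
    (Ω : Set (EuclideanSpace ℝ (Fin n))) : Prop :=
  ∀ x ∈ Ω,
    ∑ i, pderiv' (fun y => pderiv' u i y / Real.sqrt (1 + gradSq u y)) i x = 0

/-- The point `(x, u x) ∈ ℝ^{n+1}` on the graph of `u`. -/
noncomputable def graphPt {n : ℕ} (u : EuclideanSpace ℝ (Fin n) → ℝ)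
    (x : EuclideanSpace ℝ (Fin n)) : EuclideanSpace ℝ (Fin (n + 1)) :=
  (EuclideanSpace.equiv (Fin (n + 1)) ℝ).symm
    (Fin.snoc (EuclideanSpace.equiv (Fin n) ℝ x) (u x))


lemma aux_fderiv_apply {n : ℕ} (u : EuclideanSpace ℝ (Fin n) → ℝ) (x v : EuclideanSpace ℝ (Fin n)) :
    fderiv ℝ u x v = ∑ i, pderiv' u i x * v i := by
  conv_lhs => rw [← (EuclideanSpace.basisFun (Fin n) ℝ).sum_repr v]
  simp [map_sum, pderiv', mul_comm]

lemma aux_gradSq {n : ℕ} (u : EuclideanSpace ℝ (Fin n) → ℝ) (x : EuclideanSpace ℝ (Fin n)) :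
    gradSq u x = ‖fderiv ℝ u x‖ ^ 2 := by
  set a := (InnerProductSpace.toDual ℝ (EuclideanSpace ℝ (Fin n))).symm (fderiv ℝ u x) with ha
  have h1 : ‖a‖ = ‖fderiv ℝ u x‖ := by simp [ha]
  have h2 : ∀ i, a i = pderiv' u i x := by
    intro i
    have : ⟪a, EuclideanSpace.single i 1⟫ = fderiv ℝ u x (EuclideanSpace.single i 1) := by
      simp [ha]
    rw [pderiv', ← this, EuclideanSpace.inner_single_right]; simp
  rw [← h1, EuclideanSpace.norm_sq_eq, gradSq]
  simp [h2]

lemma aux_graph_norm {n : ℕ} (u : EuclideanSpace ℝ (Fin n) → ℝ) (x y : EuclideanSpace ℝ (Fin n)) :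
    ‖graphPt u x - graphPt u y‖ ^ 2 = ‖x - y‖ ^ 2 + (u x - u y) ^ 2 := by
  rw [EuclideanSpace.norm_sq_eq, EuclideanSpace.norm_sq_eq, Fin.sum_univ_castSucc]
  simp [graphPt]

lemma aux_graph_norm0 {n : ℕ} (u : EuclideanSpace ℝ (Fin n) → ℝ) (x : EuclideanSpace ℝ (Fin n)) :
    ‖graphPt u x‖ ^ 2 = ‖x‖ ^ 2 + (u x) ^ 2 := by
  rw [EuclideanSpace.norm_sq_eq, EuclideanSpace.norm_sq_eq, Fin.sum_univ_castSucc]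
  simp [graphPt]

/-- Comparison linear map for a graph with slope `L`. -/
lemma aux_linear {n : ℕ} (L : EuclideanSpace ℝ (Fin n) →L[ℝ] ℝ) :
    ∃ D : EuclideanSpace ℝ (Fin n) →ₗ[ℝ] EuclideanSpace ℝ (Fin n),
      |LinearMap.det D| ≤ 2 * Real.sqrt (1 + ‖L‖ ^ 2) ∧
      ∀ z, ‖z‖ ^ 2 + (L z) ^ 2 ≤ ‖D z‖ ^ 2 := by
  set a := (InnerProductSpace.toDual ℝ (EuclideanSpace ℝ (Fin n))).symm L with ha
  have h1 : ‖a‖ = ‖L‖ := by simp [ha]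
  have hL : ∀ z, ⟪a, z⟫ = L z := by intro z; simp [ha]
  set W := Real.sqrt (1 + ‖L‖ ^ 2) with hW
  have hW2 : W ^ 2 = 1 + ‖L‖ ^ 2 := Real.sq_sqrt (by positivity)
  have hW1 : 1 ≤ W := by rw [hW]; apply Real.one_le_sqrt.2; nlinarith [sq_nonneg ‖L‖]
  have hWp : 0 < W := by linarith
  have hLa : L a = ‖L‖ ^ 2 := by rw [← hL, real_inner_self_eq_norm_sq, h1]
  refine ⟨LinearMap.transvection (L : EuclideanSpace ℝ (Fin n) →ₗ[ℝ] ℝ) (W⁻¹ • a), ?_, ?_⟩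
  · rw [LinearMap.transvection.det]
    have : (L : EuclideanSpace ℝ (Fin n) →ₗ[ℝ] ℝ) (W⁻¹ • a) = W - W⁻¹ := by
      simp [hLa]
      field_simp
      linarith
    rw [this, abs_of_nonneg]
    · have : 0 < W⁻¹ := by positivity
      linarith
    · have : W⁻¹ ≤ 1 := inv_le_one_of_one_le₀ hW1
      linarith
  · intro z
    have hz : LinearMap.transvection (L : EuclideanSpace ℝ (Fin n) →ₗ[ℝ] ℝ) (W⁻¹ • a) z
        = z + (L z * W⁻¹) • a := by
      simp [LinearMap.transvection.apply, smul_smul]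
    rw [hz, norm_add_sq_real, inner_smul_right, real_inner_comm, hL, norm_smul, mul_pow, h1,
      Real.norm_eq_abs, sq_abs]
    have h3 : ‖L‖ ^ 2 = W ^ 2 - 1 := by linarith
    rw [h3]
    have h4 : (L z * W⁻¹) ^ 2 * (W ^ 2 - 1) = (L z)^2 - (L z)^2 * (W⁻¹)^2 := by
      field_simp
    rw [h4]
    have h5 : W⁻¹ ≤ 1 := inv_le_one_of_one_le₀ hW1
    have h6 : 0 < W⁻¹ := by positivity
    have h7 : (W⁻¹) ^ 2 ≤ 2 * W⁻¹ := by nlinarith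
    nlinarith [mul_le_mul_of_nonneg_left h7 (sq_nonneg (L z))]

lemma aux_local {n : ℕ} (u : EuclideanSpace ℝ (Fin n) → ℝ) (L : EuclideanSpace ℝ (Fin n) →L[ℝ] ℝ)
    (S : Set (EuclideanSpace ℝ (Fin n)))
    (h : ∀ x ∈ S, ∀ y ∈ S, |u x - u y - L (x - y)| ≤ ‖x - y‖) :
    μH[(n : ℝ)] (graphPt u '' S) ≤
      (2 : ℝ≥0∞) ^ n * ENNReal.ofReal (2 * Real.sqrt (1 + ‖L‖ ^ 2)) *
        μH[(n : ℝ)] S := by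
  obtain ⟨D, hdet, hD⟩ := aux_linear L
  have hinj : Function.Injective D := by
    rw [← LinearMap.ker_eq_bot, LinearMap.ker_eq_bot']
    intro z hz
    have := hD z
    rw [hz] at this
    have h0 : ‖z‖ ^ 2 ≤ 0 := by simp at this; nlinarith [sq_nonneg (L z)]
    have : ‖z‖ = 0 := by nlinarith [norm_nonneg z]
    simpa using this
  have hlip : LipschitzOnWith 2 (graphPt u ∘ Function.invFun D) (D '' S) := by
    apply LipschitzOnWith.of_dist_le_mul
    rintro _ ⟨x, hx, rfl⟩ _ ⟨y, hy, rfl⟩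
    simp only [Function.comp, Function.leftInverse_invFun hinj _]
    rw [dist_eq_norm, dist_eq_norm, ← map_sub]
    have h1 := h x hx y hy
    have h2 := hD (x - y)
    have h3 := aux_graph_norm u x y
    apply le_of_sq_le_sq _ (by positivity)
    rw [mul_pow, h3]
    have h4 : (u x - u y - L (x - y)) ^ 2 ≤ ‖x - y‖ ^ 2 := by
      rw [← sq_abs]; gcongr
    simp only [NNReal.coe_ofNat]
    nlinarith [sq_nonneg (u x - u y - 2 * L (x - y))]
  have himg : graphPt u '' S = (graphPt u ∘ Function.invFun D) '' (D '' S) := by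
    rw [← image_comp]
    apply image_congr
    intro x _
    simp [Function.leftInverse_invFun hinj x]
  rw [himg]
  refine (hlip.hausdorffMeasure_image_le (by positivity)).trans ?_
  have : Measure.IsAddHaarMeasure (G := EuclideanSpace ℝ (Fin n)) μH[(n : ℝ)] := by
    simpa using MeasureTheory.isAddHaarMeasure_hausdorffMeasure (E := EuclideanSpace ℝ (Fin n))
  rw [Measure.addHaar_image_linearMap, mul_assoc]
  gcongr
  simp

lemma aux_area {n : ℕ} (u : EuclideanSpace ℝ (Fin n) → ℝ)
    (Ω : Set (EuclideanSpace ℝ (Fin n))) (hΩ : IsOpen Ω) (hu : ContDiffOn ℝ 2 u Ω)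
    (S : Set (EuclideanSpace ℝ (Fin n))) (hS : MeasurableSet S) (hSΩ : S ⊆ Ω) :
    μH[(n : ℝ)] (graphPt u '' S) ≤
      (2 : ℝ≥0∞) ^ n * 4 * ∫⁻ x in S, ENNReal.ofReal (Real.sqrt (1 + gradSq u x)) ∂μH[(n : ℝ)] := by
  have hcont : ContinuousOn (fderiv ℝ u) Ω := hu.continuousOn_fderiv_of_isOpen hΩ (by norm_num)
  have hloc : ∀ x ∈ Ω, ∃ ε > 0, ball x ε ⊆ Ω ∧ ∀ y ∈ ball x ε, ‖fderiv ℝ u y - fderiv ℝ u x‖ ≤ 1 := by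
    intro x hx
    have h1 := (hcont.continuousAt (hΩ.mem_nhds hx))
    have h2 := (Metric.continuousAt_iff.1 h1) 1 one_pos
    obtain ⟨δ, hδ, h2⟩ := h2
    obtain ⟨ε, hε, h3⟩ := Metric.isOpen_iff.1 hΩ x hx
    refine ⟨min δ ε, lt_min hδ hε, (ball_subset_ball (min_le_right _ _)).trans h3, ?_⟩
    intro y hy
    rw [← dist_eq_norm]
    exact (h2 (lt_of_lt_of_le hy (min_le_left _ _))).le
  have hpiece : ∀ x ∈ Ω, ∀ ε, ball x ε ⊆ Ω →
      (∀ y ∈ ball x ε, ‖fderiv ℝ u y - fderiv ℝ u x‖ ≤ 1) → ∀ T ⊆ ball x ε, MeasurableSet T →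
      μH[(n : ℝ)] (graphPt u '' T) ≤
      (2 : ℝ≥0∞) ^ n * 4 * ∫⁻ x in T, ENNReal.ofReal (Real.sqrt (1 + gradSq u x)) ∂μH[(n : ℝ)] := by
    intro x hx ε hb hd T hT hTm
    refine (aux_local u (fderiv ℝ u x) T ?_).trans ?_
    · intro y hy z hz
      have := (convex_ball x ε).norm_image_sub_le_of_norm_hasFDerivWithin_le' (f := u)
        (f' := fderiv ℝ u) (φ := fderiv ℝ u x) (C := 1)
        (fun w hw => ((hu.contDiffAt (hΩ.mem_nhds (hb hw))).differentiableAt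
          (by norm_num)).hasFDerivAt.hasFDerivWithinAt) hd (hT hz) (hT hy)
      simpa using this
    · rw [mul_assoc, mul_assoc]
      refine mul_le_mul' le_rfl ?_
      rw [← setLIntegral_const, ← lintegral_const_mul' _ _ (by norm_num)]
      apply setLIntegral_mono' hTm
      intro y hy
      have h4 : (4 : ℝ≥0∞) = ENNReal.ofReal 4 := by norm_num
      rw [h4, ← ENNReal.ofReal_mul (by norm_num)]
      apply ENNReal.ofReal_le_ofReal
      rw [aux_gradSq]
      have h5 := hd y (hT hy)
      have h6 : ‖fderiv ℝ u x‖ ≤ ‖fderiv ℝ u y‖ + 1 := by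
        have := norm_sub_norm_le (fderiv ℝ u x) (fderiv ℝ u y)
        rw [norm_sub_rev] at this
        linarith
      have h7 : Real.sqrt (1 + ‖fderiv ℝ u x‖ ^ 2) ≤ 2 * Real.sqrt (1 + ‖fderiv ℝ u y‖ ^ 2) := by
        rw [Real.sqrt_le_left (by positivity), mul_pow, Real.sq_sqrt (by positivity)]
        nlinarith [norm_nonneg (fderiv ℝ u x), norm_nonneg (fderiv ℝ u y), sq_nonneg (‖fderiv ℝ u y‖ - 1)]
      linarith
  choose! ε hε hb hd using hloc
  obtain ⟨t, htS, htc, hcov⟩ := TopologicalSpace.countable_cover_nhdsWithin (s := Ω)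
    (f := fun x => ball x (ε x)) (fun x hx => mem_nhdsWithin_of_mem_nhds (ball_mem_nhds x (hε x hx)))
  rcases t.eq_empty_or_nonempty with rfl | htne
  · have : S = ∅ := by
      have : Ω ⊆ ∅ := by simpa using hcov
      exact subset_empty_iff.1 (hSΩ.trans this)
    simp [this]
  obtain ⟨g, hg⟩ := htc.exists_eq_range htne
  have hgΩ : ∀ k, g k ∈ Ω := fun k => htS (hg ▸ mem_range_self k)
  set B : ℕ → Set (EuclideanSpace ℝ (Fin n)) := fun k => S ∩ ball (g k) (ε (g k)) with hB
  have hSB : S = ⋃ k, disjointed B k := by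
    rw [iUnion_disjointed, ← inter_iUnion, eq_comm, inter_eq_left]
    refine hSΩ.trans (hcov.trans ?_)
    rw [hg]; simp
  have hBm : ∀ k, MeasurableSet (disjointed B k) :=
    fun k => MeasurableSet.disjointed (fun j => hS.inter measurableSet_ball) k
  have hsub : ∀ k, disjointed B k ⊆ ball (g k) (ε (g k)) :=
    fun k => (disjointed_subset B k).trans inter_subset_right
  conv_lhs => rw [hSB, image_iUnion]
  conv_rhs => rw [hSB, lintegral_iUnion hBm (disjoint_disjointed B), ← ENNReal.tsum_mul_left]
  refine (measure_iUnion_le _).trans (ENNReal.tsum_le_tsum fun k => ?_)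
  exact hpiece _ (hgΩ k) _ (hb _ (hgΩ k)) (hd _ (hgΩ k)) _ (hsub k) (hBm k)

/-- Integral of a directional derivative over a compact convex set, by Fubini and the
fundamental theorem of calculus on lines. -/
lemma aux_line {m : ℕ} (i : Fin (m + 1)) (K : Set (Fin (m + 1) → ℝ)) (hK : IsCompact K)
    (hKc : Convex ℝ K) (F F' : (Fin (m + 1) → ℝ) → ℝ) (M R : ℝ)
    (hR : 0 ≤ R) (hM : 0 ≤ M)
    (hcube : ∀ x ∈ K, ∀ j, x j ∈ Icc (-R) R)
    (hF : ∀ x ∈ K, |F x| ≤ M)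
    (hF' : ContinuousOn F' K)
    (hder : ∀ (z : Fin m → ℝ) (t : ℝ), (Fin.insertNth i t z : Fin (m + 1) → ℝ) ∈ K →
      HasDerivAt (fun s : ℝ => F (Fin.insertNth i s z : Fin (m + 1) → ℝ))
        (F' (Fin.insertNth i t z : Fin (m + 1) → ℝ)) t) :
    ∫ x in K, F' x ≤ 2 * M * (2 * R) ^ m := by
  have hmp := (volume_preserving_piFinSuccAbove (fun _ : Fin (m + 1) => ℝ) i).symm
  have hint : Integrable (K.indicator F') :=
    (integrable_indicator_iff hK.measurableSet).2 (hF'.integrableOn_compact hK)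
  set e := (MeasurableEquiv.piFinSuccAbove (fun _ : Fin (m + 1) => ℝ) i).symm with he
  have heapp : ∀ t z, e (t, z) = (Fin.insertNth i t z : Fin (m + 1) → ℝ) := fun t z => rfl
  rw [← integral_indicator hK.measurableSet, ← hmp.integral_comp e.measurableEmbedding]
  have hint2 : Integrable (fun p => K.indicator F' (e p)) :=
    (hmp.integrable_comp_emb e.measurableEmbedding).2 hint
  rw [Measure.volume_eq_prod] at hint2 ⊢
  rw [integral_prod_symm _ hint2]
  have hinner : ∀ z : Fin m → ℝ, ∫ t, K.indicator F' (e (t, z)) ≤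
      (Icc (fun _ => -R) (fun _ => R) : Set (Fin m → ℝ)).indicator (fun _ => 2 * M) z := by
    intro z
    set Sz : Set ℝ := (fun t : ℝ => (Fin.insertNth i t z : Fin (m + 1) → ℝ)) ⁻¹' K with hSz
    have hcontL : Continuous (fun t : ℝ => (Fin.insertNth i t z : Fin (m + 1) → ℝ)) :=
      continuous_pi fun j => Fin.succAboveCases i (by simpa using continuous_id')
        (fun k => by simpa using continuous_const) j
    have hrw : (fun t => K.indicator F' (e (t, z))) =
        Sz.indicator (fun t => F' (Fin.insertNth i t z : Fin (m + 1) → ℝ)) := by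
      ext t
      rfl
    rw [hrw]
    rcases Sz.eq_empty_or_nonempty with h0 | hne
    · rw [h0]
      simp only [indicator_empty, integral_zero]
      exact indicator_nonneg (fun _ _ => by positivity) z
    have hzc : z ∈ (Icc (fun _ => -R) (fun _ => R) : Set (Fin m → ℝ)) := by
      obtain ⟨t, ht⟩ := hne
      constructor
      · intro j
        have := (hcube _ ht (i.succAbove j)).1
        simpa using this
      · intro j
        have := (hcube _ ht (i.succAbove j)).2
        simpa using this
    rw [indicator_of_mem hzc]
    have hSclosed : IsClosed Sz := hK.isClosed.preimage hcontL
    have hSsub : Sz ⊆ Icc (-R) R := by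
      intro t ht
      have := hcube _ ht i
      simpa using this
    have hScomp : IsCompact Sz := isCompact_Icc.of_isClosed_subset hSclosed hSsub
    have hSconv : Convex ℝ Sz := by
      intro s hs t ht a b ha hb hab
      have := hKc hs ht ha hb hab
      simp only [hSz, mem_preimage] 
      convert this using 1
      ext j
      refine Fin.succAboveCases i ?_ (fun k => ?_) j
      · simp
      · simp only [Fin.insertNth_apply_succAbove, Pi.add_apply, Pi.smul_apply, smul_eq_mul]
        rw [← add_mul, hab, one_mul]
    have hSconn : IsConnected Sz := ⟨hne, hSconv.isPreconnected⟩
    have hSI := eq_Icc_of_connected_compact hSconn hScomp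
    set a := sInf Sz
    set b := sSup Sz
    have hab : a ≤ b := by
      rw [← nonempty_Icc, ← hSI]; exact hne
    have haS : a ∈ Sz := by rw [hSI]; exact left_mem_Icc.2 hab
    have hbS : b ∈ Sz := by rw [hSI]; exact right_mem_Icc.2 hab
    rw [integral_indicator hSclosed.measurableSet, hSI, integral_Icc_eq_integral_Ioc,
      ← intervalIntegral.integral_of_le hab]
    rw [intervalIntegral.integral_eq_sub_of_hasDerivAt
      (f := fun s : ℝ => F (Fin.insertNth i s z : Fin (m + 1) → ℝ))]
    · have h1 := abs_le.1 (hF _ haS)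
      have h2 := abs_le.1 (hF _ hbS)
      linarith [h1.1, h2.2]
    · intro t ht
      rw [uIcc_of_le hab, ← hSI] at ht
      exact hder z t ht
    · apply ContinuousOn.intervalIntegrable
      rw [uIcc_of_le hab, ← hSI]
      exact hF'.comp hcontL.continuousOn (fun t ht => ht)
  have hIcc : MeasurableSet (Icc (fun _ => -R) (fun _ => R) : Set (Fin m → ℝ)) := measurableSet_Icc
  have hvol : volume (Icc (fun _ => -R) (fun _ => R) : Set (Fin m → ℝ)) =
      ENNReal.ofReal ((2 * R) ^ m) := by
    rw [Real.volume_Icc_pi]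
    simp only [Finset.prod_const, Finset.card_univ, Fintype.card_fin]
    rw [← ENNReal.ofReal_pow (by linarith)]
    congr 2; ring
  refine (integral_mono hint2.integral_prod_right ?_ hinner).trans ?_
  · rw [integrable_indicator_iff hIcc]
    exact integrableOn_const (by rw [hvol]; simp)
  · rw [integral_indicator hIcc, setIntegral_const, Measure.real, hvol,
      ENNReal.toReal_ofReal (by positivity), smul_eq_mul]
    linarith

lemma aux_lineE {m : ℕ} (i : Fin (m + 1)) (Ω K : Set (EuclideanSpace ℝ (Fin (m + 1))))
    (hΩ : IsOpen Ω) (hK : IsCompact K) (hKΩ : K ⊆ Ω)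
    (hKc : Convex ℝ K) (Y : EuclideanSpace ℝ (Fin (m + 1)) → ℝ) (M R : ℝ)
    (hR : 0 ≤ R) (hM : 0 ≤ M)
    (hcube : K ⊆ closedBall 0 R)
    (hY : ContDiffOn ℝ 1 Y Ω)
    (hF : ∀ x ∈ K, |Y x| ≤ M) :
    ∫ x in K, pderiv' Y i x ≤ 2 * M * (2 * R) ^ m := by
  have hmp := PiLp.volume_preserving_toLp (Fin (m + 1))
  have hemb := (MeasurableEquiv.toLp 2 (Fin (m + 1) → ℝ)).measurableEmbedding
  have hcont : ContinuousOn (pderiv' Y i) Ω :=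
    (hY.continuousOn_fderiv_of_isOpen hΩ le_rfl).clm_apply continuousOn_const
  have hct : Continuous (WithLp.toLp 2 : (Fin (m + 1) → ℝ) → EuclideanSpace ℝ (Fin (m + 1))) :=
    PiLp.continuous_toLp 2 _
  rw [← hmp.setIntegral_preimage_emb hemb]
  refine aux_line i _ ?_ ?_ (fun x => Y (WithLp.toLp 2 x)) _ M R hR hM ?_ ?_ ?_ ?_
  · exact (PiLp.homeomorph 2 (fun _ : Fin (m + 1) => ℝ)).symm.isClosedEmbedding.isCompact_preimage hK
  · exact hKc.linear_preimage (WithLp.linearEquiv 2 ℝ (Fin (m + 1) → ℝ)).symm.toLinearMap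
  · intro x hx j
    have h1 := hcube hx
    rw [mem_closedBall_zero_iff] at h1
    have h2 := (PiLp.norm_apply_le (WithLp.toLp 2 x) j).trans h1
    exact abs_le.1 h2
  · intro x hx
    exact hF _ hx
  · exact (hcont.mono hKΩ).comp hct.continuousOn (fun x hx => hx)
  · intro z t ht
    have h1 : HasFDerivAt Y (fderiv ℝ Y _) (WithLp.toLp 2 (Fin.insertNth i t z : Fin (m + 1) → ℝ)) :=
      ((hY.contDiffAt (hΩ.mem_nhds (hKΩ ht))).differentiableAt (by norm_num)).hasFDerivAt
    have h2 : HasDerivAt (fun s : ℝ => (WithLp.toLp 2 (Fin.insertNth i s z : Fin (m + 1) → ℝ)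
        : EuclideanSpace ℝ (Fin (m + 1)))) (EuclideanSpace.single i 1) t := by
      have h3 : (fun s : ℝ => (WithLp.toLp 2 (Fin.insertNth i s z : Fin (m + 1) → ℝ)
        : EuclideanSpace ℝ (Fin (m + 1)))) = fun s => s • EuclideanSpace.single i 1 +
          WithLp.toLp 2 (Fin.insertNth i 0 z : Fin (m + 1) → ℝ) := by
        ext s j
        refine Fin.succAboveCases i ?_ (fun k => ?_) j
        · simp
        · simp
      rw [h3]
      simpa using ((hasDerivAt_id t).smul_const (EuclideanSpace.single i (1 : ℝ))).add_const
        (WithLp.toLp 2 (Fin.insertNth i 0 z : Fin (m + 1) → ℝ))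
    exact h1.comp_hasDerivAt t h2

/-- Energy estimate on compact convex subsets. -/
lemma aux_energy {m : ℕ} (Ω K : Set (EuclideanSpace ℝ (Fin (m + 1))))
    (u : EuclideanSpace ℝ (Fin (m + 1)) → ℝ)
    (hΩ : IsOpen Ω) (hK : IsCompact K) (hKΩ : K ⊆ Ω) (hKc : Convex ℝ K)
    (hu : ContDiffOn ℝ 2 u Ω) (hmin : MinimalSurfaceEq u Ω) (r : ℝ) (hr : 0 < r)
    (hcube : K ⊆ closedBall 0 r) :
    IntegrableOn (fun x => 1 / (1 + (u x / r) ^ 2) * (gradSq u x / Real.sqrt (1 + gradSq u x))) K ∧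
    ∫ x in K, 1 / (1 + (u x / r) ^ 2) * (gradSq u x / Real.sqrt (1 + gradSq u x)) ≤
      (m + 1) * (2 * (2 * r) * (2 * r) ^ m) := by
  have hp : ∀ i, ContDiffOn ℝ 1 (pderiv' u i) Ω := fun i =>
    (hu.fderiv_of_isOpen hΩ (m := 1) (by norm_num)).clm_apply contDiffOn_const
  have hg : ContDiffOn ℝ 1 (gradSq u) Ω := by
    unfold gradSq
    exact ContDiffOn.sum fun i _ => (hp i).pow 2
  have hgn : ∀ x, 0 ≤ gradSq u x := fun x => Finset.sum_nonneg fun i _ => sq_nonneg _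
  have hW : ContDiffOn ℝ 1 (fun x => Real.sqrt (1 + gradSq u x)) Ω :=
    (contDiffOn_const.add hg).sqrt (fun x _ => by have := hgn x; positivity)
  have hWp : ∀ x, 0 < Real.sqrt (1 + gradSq u x) := fun x =>
    Real.sqrt_pos.2 (by have := hgn x; positivity)
  have hX : ∀ i, ContDiffOn ℝ 1 (fun y => pderiv' u i y / Real.sqrt (1 + gradSq u y)) Ω :=
    fun i => (hp i).div hW (fun x _ => (hWp x).ne')
  have hu1 : ContDiffOn ℝ 1 u Ω := hu.of_le (by norm_num)
  have hT : ContDiffOn ℝ 1 (fun x => r * Real.arctan (u x / r)) Ω :=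
    contDiffOn_const.mul (Real.contDiff_arctan.comp_contDiffOn (hu1.div_const r))
  set Y : Fin (m + 1) → EuclideanSpace ℝ (Fin (m + 1)) → ℝ := fun i x =>
    (r * Real.arctan (u x / r)) * (pderiv' u i x / Real.sqrt (1 + gradSq u x)) with hYdef
  have hY : ∀ i, ContDiffOn ℝ 1 (Y i) Ω := fun i => hT.mul (hX i)
  have hYb : ∀ i, ∀ x, |Y i x| ≤ 2 * r := by
    intro i x
    rw [hYdef]
    simp only
    rw [abs_mul, abs_mul, abs_of_pos hr]
    have h1 : |Real.arctan (u x / r)| ≤ 2 := by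
      rw [abs_le]
      constructor
      · linarith [Real.neg_pi_div_two_lt_arctan (u x / r), Real.pi_lt_four]
      · linarith [Real.arctan_lt_pi_div_two (u x / r), Real.pi_lt_four]
    have h2 : |pderiv' u i x / Real.sqrt (1 + gradSq u x)| ≤ 1 := by
      rw [abs_div, abs_of_pos (hWp x), div_le_one (hWp x)]
      apply Real.le_sqrt_of_sq_le
      rw [sq_abs]
      have : pderiv' u i x ^ 2 ≤ gradSq u x :=
        Finset.single_le_sum (f := fun j => pderiv' u j x ^ 2) (fun j _ => sq_nonneg _)
          (Finset.mem_univ i)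
      linarith
    calc r * |Real.arctan (u x / r)| * |pderiv' u i x / Real.sqrt (1 + gradSq u x)|
        ≤ r * 2 * 1 := by gcongr
      _ = 2 * r := by ring
  have hdiv : ∀ x ∈ Ω, 1 / (1 + (u x / r) ^ 2) * (gradSq u x / Real.sqrt (1 + gradSq u x)) =
      ∑ i, pderiv' (Y i) i x := by
    intro x hx
    have hnb := hΩ.mem_nhds hx
    have hTd : HasFDerivAt (fun x => r * Real.arctan (u x / r))
        ((1 / (1 + (u x / r) ^ 2)) • fderiv ℝ u x) x := by
      have h1 : HasFDerivAt u (fderiv ℝ u x) x :=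
        ((hu1.contDiffAt hnb).differentiableAt (by norm_num)).hasFDerivAt
      have h2 : HasDerivAt (fun t => r * Real.arctan (t / r)) (1 / (1 + (u x / r) ^ 2)) (u x) := by
        have := (((hasDerivAt_id (u x)).div_const r).arctan).const_mul r
        refine this.congr_deriv ?_
        change r * (1 / (1 + (u x / r) ^ 2) * (1 / r)) = _
        field_simp
      exact h2.comp_hasFDerivAt x h1
    have hterm : ∀ i, pderiv' (Y i) i x =
        (r * Real.arctan (u x / r)) *
          pderiv' (fun y => pderiv' u i y / Real.sqrt (1 + gradSq u y)) i x +
        1 / (1 + (u x / r) ^ 2) * (pderiv' u i x ^ 2 / Real.sqrt (1 + gradSq u x)) := by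
      intro i
      have hXd := (((hX i).contDiffAt hnb).differentiableAt (by norm_num)).hasFDerivAt
      have := (hTd.mul hXd).fderiv
      rw [pderiv']
      have h3 : fderiv ℝ (Y i) x = _ := this
      rw [h3]
      simp only [pderiv', add_apply, smul_apply, smul_eq_mul]
      ring
    rw [Finset.sum_congr rfl (fun i _ => hterm i), Finset.sum_add_distrib, ← Finset.mul_sum,
      hmin x hx, mul_zero, zero_add, ← Finset.mul_sum, ← Finset.sum_div]
    rfl
  have hYc : ∀ i, IntegrableOn (pderiv' (Y i) i) K := fun i =>
    ((((hY i).continuousOn_fderiv_of_isOpen hΩ le_rfl).clm_apply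
      continuousOn_const).mono hKΩ).integrableOn_compact hK
  constructor
  · refine (integrable_finsetSum Finset.univ (fun i _ => hYc i)).congr ?_
    filter_upwards [ae_restrict_mem hK.measurableSet] with x hx
    exact (hdiv x (hKΩ hx)).symm
  · rw [setIntegral_congr_fun hK.measurableSet (fun x hx => hdiv x (hKΩ hx)),
      integral_finsetSum _ (fun i _ => hYc i)]
    calc _ ≤ ∑ i : Fin (m + 1), (2 * (2 * r) * (2 * r) ^ m) :=
          Finset.sum_le_sum fun i _ => aux_lineE i Ω K hΩ hK hKΩ hKc (Y i) (2 * r) r hr.le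
            (by positivity) hcube (hY i) (fun x _ => hYb i x)
      _ = _ := by simp

/-- Exhaustion of a convex open set by compact convex subsets. -/
lemma aux_exhaust {n : ℕ} (Ω : Set (EuclideanSpace ℝ (Fin n))) (hne : Ω.Nonempty)
    (hΩ : IsOpen Ω) (hc : Convex ℝ Ω) (r : ℝ) :
    ∃ K : ℕ → Set (EuclideanSpace ℝ (Fin n)), Monotone K ∧ (∀ k, IsCompact (K k)) ∧
      (∀ k, Convex ℝ (K k)) ∧ (∀ k, K k ⊆ Ω) ∧ (∀ k, K k ⊆ closedBall 0 r) ∧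
      Ω ∩ ball 0 r ⊆ ⋃ k, K k := by
  set K : ℕ → Set (EuclideanSpace ℝ (Fin n)) := fun k => closedBall 0 r ∩
    ⋂ v ∈ ball (0 : EuclideanSpace ℝ (Fin n)) (1 / (k + 1 : ℝ)), (fun x => v + x) ⁻¹' closure Ω
    with hK
  have hint : interior (closure Ω) = Ω := by
    rw [hc.interior_closure_eq_interior_of_nonempty_interior (by rwa [hΩ.interior_eq]),
      hΩ.interior_eq]
  refine ⟨K, ?_, ?_, ?_, ?_, ?_, ?_⟩
  · intro j k hjk
    apply inter_subset_inter_right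
    apply biInter_subset_biInter_left
    apply ball_subset_ball
    gcongr
  · intro k
    refine (isCompact_closedBall 0 r).inter_right ?_
    exact isClosed_biInter fun v _ => isClosed_closure.preimage (by fun_prop)
  · intro k
    refine (convex_closedBall 0 r).inter ?_
    exact convex_iInter₂ fun v _ => hc.closure.translate_preimage_right v
  · intro k x hx
    rw [← hint, mem_interior]
    refine ⟨ball x (1 / (k + 1 : ℝ)), ?_, isOpen_ball, mem_ball_self (by positivity)⟩
    intro y hy
    have := mem_iInter₂.1 hx.2 (y - x) (by simpa [dist_eq_norm] using hy)
    simpa using this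
  · exact fun k => inter_subset_left
  · rintro x ⟨hx, hxr⟩
    obtain ⟨ε, hε, hb⟩ := Metric.isOpen_iff.1 hΩ x hx
    obtain ⟨k, hk⟩ := exists_nat_one_div_lt hε
    refine mem_iUnion.2 ⟨k, ball_subset_closedBall hxr, mem_iInter₂.2 fun v hv => ?_⟩
    apply subset_closure
    apply hb
    rw [mem_ball_zero_iff] at hv
    simpa [dist_eq_norm] using hv.trans hk

lemma aux_main {m : ℕ} (Ω : Set (EuclideanSpace ℝ (Fin (m + 1))))
    (u : EuclideanSpace ℝ (Fin (m + 1)) → ℝ) (hne : Ω.Nonempty)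
    (hΩ : IsOpen Ω) (hc : Convex ℝ Ω)
    (hu : ContDiffOn ℝ 2 u Ω) (hmin : MinimalSurfaceEq u Ω) (r : ℝ) (hr : 0 < r) :
    ∫⁻ x in {x ∈ Ω | ‖x‖ < r ∧ |u x| < r}, ENNReal.ofReal (Real.sqrt (1 + gradSq u x)) ≤
      volume (ball (0 : EuclideanSpace ℝ (Fin (m + 1))) r) +
        2 * ENNReal.ofReal ((m + 1) * (2 * (2 * r) * (2 * r) ^ m)) := by
  set S := {x ∈ Ω | ‖x‖ < r ∧ |u x| < r} with hS
  set g : EuclideanSpace ℝ (Fin (m + 1)) → ℝ := fun x =>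
    1 / (1 + (u x / r) ^ 2) * (gradSq u x / Real.sqrt (1 + gradSq u x)) with hgdef
  have hgn : ∀ x, 0 ≤ gradSq u x := fun x => Finset.sum_nonneg fun i _ => sq_nonneg _
  have hg0 : ∀ x, 0 ≤ g x := fun x => by have := hgn x; simp only [hgdef]; positivity
  have hSm : MeasurableSet S := by
    have : S = (Ω ∩ u ⁻¹' (Ioo (-r) r)) ∩ ball 0 r := by
      ext x; simp only [hS, abs_lt, mem_ofPred_eq, mem_inter_iff, mem_preimage, mem_Ioo,
        mem_ball_zero_iff]; tauto
    rw [this]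
    exact ((hu.continuousOn.isOpen_inter_preimage hΩ isOpen_Ioo).inter isOpen_ball).measurableSet
  have hpt : ∀ x ∈ S, ENNReal.ofReal (Real.sqrt (1 + gradSq u x)) ≤
      1 + 2 * ENNReal.ofReal (g x) := by
    intro x hx
    have h2 : (2 : ℝ≥0∞) = ENNReal.ofReal 2 := by norm_num
    rw [h2, ← ENNReal.ofReal_mul (by norm_num), ← ENNReal.ofReal_one,
      ← ENNReal.ofReal_add (by norm_num) (by have := hg0 x; positivity)]
    apply ENNReal.ofReal_le_ofReal
    have hG := hgn x
    set G := gradSq u x with hGdef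
    set W := Real.sqrt (1 + G) with hW
    have hW2 : W ^ 2 = 1 + G := Real.sq_sqrt (by positivity)
    have hW1 : 1 ≤ W := by rw [hW]; apply Real.one_le_sqrt.2; linarith
    have hq : (u x / r) ^ 2 ≤ 1 := by
      rw [div_pow, div_le_one (by positivity), ← sq_abs (u x)]
      have := hx.2.2.le
      gcongr
    have h3 : 1 / 2 ≤ 1 / (1 + (u x / r) ^ 2) := by
      apply one_div_le_one_div_of_le (by positivity); linarith
    have h4 : W ≤ 1 + G / W := by
      have : W = W⁻¹ + G / W := by field_simp; linarith
      have : W⁻¹ ≤ 1 := inv_le_one_of_one_le₀ hW1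
      linarith
    have h5 : 1 / 2 * (G / W) ≤ g x := by
      simp only [hgdef]
      rw [← hGdef, ← hW]
      gcongr
    linarith
  obtain ⟨K, hmono, hKcomp, hKconv, hKΩ, hKr, hcov⟩ := aux_exhaust Ω hne hΩ hc r
  have hSsub : S ⊆ ⋃ k, K k := fun x hx => hcov ⟨hx.1, by simpa using hx.2.1⟩
  have hK : ∫⁻ x in ⋃ k, K k, ENNReal.ofReal (g x) ≤
      ENNReal.ofReal ((m + 1) * (2 * (2 * r) * (2 * r) ^ m)) := by
    rw [setLIntegral_iUnion_of_directed _ hmono.directed_le]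
    refine iSup_le fun k => ?_
    obtain ⟨hi, hle⟩ := aux_energy Ω (K k) u hΩ (hKcomp k) (hKΩ k) (hKconv k) hu hmin r hr (hKr k)
    rw [← ofReal_integral_eq_lintegral_ofReal hi (Filter.Eventually.of_forall hg0)]
    exact ENNReal.ofReal_le_ofReal hle
  calc ∫⁻ x in S, ENNReal.ofReal (Real.sqrt (1 + gradSq u x))
      ≤ ∫⁻ x in S, (1 + 2 * ENNReal.ofReal (g x)) := setLIntegral_mono' hSm hpt
    _ = volume S + 2 * ∫⁻ x in S, ENNReal.ofReal (g x) := by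
        rw [lintegral_add_left measurable_const, lintegral_const_mul' _ _ (by norm_num)]
        simp
    _ ≤ _ := by
        gcongr
        · intro x hx; simpa using hx.2.1
        · exact (lintegral_mono_set hSsub).trans hK

theorem graph_area_growth
    (n : ℕ) :
    ∃ c > (0 : ℝ), ∀ (Ω : Set (EuclideanSpace ℝ (Fin n)))
      (l u : EuclideanSpace ℝ (Fin n) → ℝ),
      Ω.Nonempty → IsOpen Ω → Convex ℝ Ω → Ω ≠ univ →
      LocallyLipschitz l →
      ContDiffOn ℝ 2 u Ω → ContinuousOn u (closure Ω) →
      MinimalSurfaceEq u Ω →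
      (∀ x ∈ frontier Ω, u x = l x) →
      ∀ r > (0 : ℝ),
        μH[(n : ℝ)] ({p : EuclideanSpace ℝ (Fin (n + 1)) | ∃ x ∈ Ω, p = graphPt u x}
            ∩ Metric.ball 0 r)
          ≤ ENNReal.ofReal (c * r ^ n) := by
  rcases n with _ | m
  · refine ⟨1, one_pos, ?_⟩
    intro Ω l u hne _ _ hproper
    exact absurd (Subsingleton.eq_univ_of_nonempty hne) hproper
  have : Measure.IsAddHaarMeasure (G := EuclideanSpace ℝ (Fin (m + 1))) μH[((m + 1 : ℕ) : ℝ)] := by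
    simpa using MeasureTheory.isAddHaarMeasure_hausdorffMeasure
      (E := EuclideanSpace ℝ (Fin (m + 1)))
  set κ := Measure.addHaarScalarFactor (μH[((m + 1 : ℕ) : ℝ)] :
    Measure (EuclideanSpace ℝ (Fin (m + 1)))) volume with hκ
  have hμ : (μH[((m + 1 : ℕ) : ℝ)] : Measure (EuclideanSpace ℝ (Fin (m + 1)))) = κ • volume :=
    Measure.isAddLeftInvariant_eq_smul _ _
  set V := (volume (ball (0 : EuclideanSpace ℝ (Fin (m + 1))) 1)).toReal with hV
  have hVfin : volume (ball (0 : EuclideanSpace ℝ (Fin (m + 1))) 1) = ENNReal.ofReal V :=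
    (ENNReal.ofReal_toReal measure_ball_lt_top.ne).symm
  have hV0 : 0 ≤ V := ENNReal.toReal_nonneg
  set A : ℝ := V + 2 * ((m + 1) * (2 * 2 * 2 ^ m)) with hA
  have hA0 : 0 ≤ A := by positivity
  refine ⟨2 ^ (m + 1) * 4 * (κ * A) + 1, by positivity, ?_⟩
  intro Ω l u hne hΩ hc _ _ hu _ hmin _ r hr
  set S := {x ∈ Ω | ‖x‖ < r ∧ |u x| < r} with hS
  have hSm : MeasurableSet S := by
    have : S = (Ω ∩ u ⁻¹' (Ioo (-r) r)) ∩ ball 0 r := by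
      ext x; simp only [hS, abs_lt, mem_ofPred_eq, mem_inter_iff, mem_preimage, mem_Ioo,
        mem_ball_zero_iff]; tauto
    rw [this]
    exact ((hu.continuousOn.isOpen_inter_preimage hΩ isOpen_Ioo).inter isOpen_ball).measurableSet
  have hsub : {p : EuclideanSpace ℝ (Fin (m + 1 + 1)) | ∃ x ∈ Ω, p = graphPt u x}
      ∩ Metric.ball 0 r ⊆ graphPt u '' S := by
    rintro _ ⟨⟨x, hx, rfl⟩, hb⟩
    rw [mem_ball_zero_iff] at hb
    have h1 := aux_graph_norm0 u x
    have h2 : ‖graphPt u x‖ ^ 2 < r ^ 2 := by gcongr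
    refine ⟨x, ⟨hx, ?_, ?_⟩, rfl⟩
    · apply lt_of_pow_lt_pow_left₀ 2 hr.le
      nlinarith [sq_nonneg (u x)]
    · apply lt_of_pow_lt_pow_left₀ 2 hr.le
      rw [sq_abs]
      nlinarith [sq_nonneg ‖x‖]
  have hvol : volume (ball (0 : EuclideanSpace ℝ (Fin (m + 1))) r) =
      ENNReal.ofReal (r ^ (m + 1) * V) := by
    rw [Measure.addHaar_ball _ _ hr.le, hVfin, ← ENNReal.ofReal_mul (by positivity)]
    simp
  have hgen : ∀ P Q : ℝ, 0 ≤ P → 0 ≤ Q → (2 : ℝ≥0∞) ^ (m + 1) * 4 * (κ * (ENNReal.ofReal P +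
      2 * ENNReal.ofReal Q)) = ENNReal.ofReal (2 ^ (m + 1) * 4 * (κ * (P + 2 * Q))) := by
    intro P Q hP hQ
    rw [ENNReal.ofReal_mul (by positivity), ENNReal.ofReal_mul (by positivity),
      ENNReal.ofReal_mul (p := (κ : ℝ)) (by positivity), ENNReal.ofReal_add hP (by positivity),
      ENNReal.ofReal_mul (p := 2) (by positivity), ENNReal.ofReal_pow (by positivity)]
    simp
  calc _ ≤ μH[((m + 1 : ℕ) : ℝ)] (graphPt u '' S) := measure_mono hsub
    _ ≤ _ := aux_area u Ω hΩ hu S hSm (fun x hx => hx.1)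
    _ = 2 ^ (m + 1) * 4 * (κ * ∫⁻ x in S, ENNReal.ofReal (Real.sqrt (1 + gradSq u x))) := by
        rw [hμ, Measure.restrict_smul, lintegral_smul_measure]
        rfl
    _ ≤ 2 ^ (m + 1) * 4 * (κ * (ENNReal.ofReal (r ^ (m + 1) * V) +
        2 * ENNReal.ofReal ((m + 1) * (2 * (2 * r) * (2 * r) ^ m)))) := by
        rw [← hvol]
        gcongr
        exact aux_main Ω u hne hΩ hc hu hmin r hr
    _ = ENNReal.ofReal (2 ^ (m + 1) * 4 * (κ * (r ^ (m + 1) * V +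
        2 * ((m + 1) * (2 * (2 * r) * (2 * r) ^ m))))) := by
        exact hgen _ _ (by positivity) (by positivity)
    _ ≤ _ := by
        apply ENNReal.ofReal_le_ofReal
        have h1 : r ^ (m + 1) * V + 2 * ((m + 1) * (2 * (2 * r) * (2 * r) ^ m)) =
            A * r ^ (m + 1) := by
          rw [hA, mul_pow]; ring
        rw [h1]
        have : 0 < r ^ (m + 1) := by positivity
        nlinarith
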